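/- arXiv:2506.11940 — 7 statements merged into one kernel-verified Lean document; each statement's English description precedes it below -/
import Mathlib

section
/- A pair (X*,Y*) ∈ 𝒳 × 𝒴 is a Nash equilibrium of the semidefinite game if and only if there exist real numbers w and v such that w·I_m − Φ_A(Y*) is positive semidefinite, v·I_n − Φ'_B(X*) is positive semidefinite, ⟨X*, w·I_m − Φ_A(Y*)⟩ = 0 and ⟨Y*, v·I_n − Φ'_B(X*)⟩ = 0; moreover, in that case w = p_A(X*,Y*) and v = p_B(X*,Y*). -/
open Matrix BigOperators

noncomputable section

/-- Frobenius inner product of two square matrices. -/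
def frob {p : ℕ} (M N : Matrix (Fin p) (Fin p) ℝ) : ℝ := ∑ i, ∑ j, M i j * N i j

/-- Strategy space: symmetric (Hermitian) positive semidefinite matrices of trace one. -/
def Strat (p : ℕ) : Set (Matrix (Fin p) (Fin p) ℝ) :=
  {X | X.PosSemidef ∧ X.trace = 1}

/-- `Φ_A(Y)_{ij} = Σ_{k,l} A_{ijkl} Y_{kl}`. -/
def PhiA {m n : ℕ} (A : Fin m → Fin m → Fin n → Fin n → ℝ)
    (Y : Matrix (Fin n) (Fin n) ℝ) : Matrix (Fin m) (Fin m) ℝ :=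
  Matrix.of fun i j => ∑ k, ∑ l, A i j k l * Y k l

/-- `Φ'_B(X)_{kl} = Σ_{i,j} X_{ij} B_{ijkl}`. -/
def PhiB {m n : ℕ} (B : Fin m → Fin m → Fin n → Fin n → ℝ)
    (X : Matrix (Fin m) (Fin m) ℝ) : Matrix (Fin n) (Fin n) ℝ :=
  Matrix.of fun k l => ∑ i, ∑ j, X i j * B i j k l

lemma frob_eq_trace {p : ℕ} (M N : Matrix (Fin p) (Fin p) ℝ) : frob M N = (M * Nᵀ).trace := by
  simp [frob, Matrix.trace, Matrix.mul_apply]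

lemma frob_comm {p : ℕ} (M N : Matrix (Fin p) (Fin p) ℝ) : frob M N = frob N M := by
  simp [frob, mul_comm]

lemma frob_smul_one_sub {p : ℕ} {X : Matrix (Fin p) (Fin p) ℝ} (hX : X.trace = 1)
    (c : ℝ) (M : Matrix (Fin p) (Fin p) ℝ) :
    frob X (c • (1 : Matrix (Fin p) (Fin p) ℝ) - M) = c - frob X M := by
  simp [frob_eq_trace, mul_sub, hX]

lemma frob_smul_vecMulVec {p : ℕ} (t : ℝ) (x : Fin p → ℝ) (M : Matrix (Fin p) (Fin p) ℝ) :
    frob (t • vecMulVec x x) M = t * (x ⬝ᵥ (M *ᵥ x)) := by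
  simp only [frob, Matrix.smul_apply, vecMulVec_apply, smul_eq_mul, dotProduct, mulVec, Finset.mul_sum]
  exact Finset.sum_congr rfl fun i _ => Finset.sum_congr rfl fun j _ => by ring

open scoped MatrixOrder in
lemma frob_nonneg {p : ℕ} {M N : Matrix (Fin p) (Fin p) ℝ} (hM : M.PosSemidef)
    (hN : N.PosSemidef) : 0 ≤ frob M N := by
  obtain ⟨S, rfl⟩ := CStarAlgebra.nonneg_iff_eq_star_mul_self.mp hM.nonneg
  rw [frob_eq_trace, star_eq_conjTranspose, mul_assoc, trace_mul_comm]
  exact (hN.transpose.mul_mul_conjTranspose_same S).trace_nonneg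

/-- A linear functional on the spectrahedron is bounded by `c` exactly when `c • 1` dominates the
matrix representing it. -/
lemma forall_frob_le_iff_posSemidef {p : ℕ} {M : Matrix (Fin p) (Fin p) ℝ} (hM : M.IsSymm)
    (c : ℝ) :
    (∀ X ∈ Strat p, frob X M ≤ c) ↔ (c • (1 : Matrix (Fin p) (Fin p) ℝ) - M).PosSemidef := by
  refine ⟨fun h => .of_dotProduct_mulVec_nonneg ?_ fun x => ?_, fun h X hX => ?_⟩
  · simp [IsHermitian, conjTranspose_eq_transpose_of_trivial, hM.eq]
  · rcases eq_or_ne x 0 with rfl | hx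
    · simp
    have hpos : 0 < x ⬝ᵥ x := by simpa using dotProduct_star_self_pos_iff.mpr hx
    have hmem : (x ⬝ᵥ x)⁻¹ • vecMulVec x x ∈ Strat p := by
      refine ⟨?_, ?_⟩
      · simpa using (posSemidef_vecMulVec_self_star x).smul (inv_nonneg.mpr hpos.le)
      · simp [trace_smul, trace_vecMulVec, hpos.ne']
    have hle := h _ hmem
    rw [frob_smul_vecMulVec, inv_mul_le_iff₀ hpos] at hle
    simp only [sub_mulVec, smul_mulVec, one_mulVec, dotProduct_sub, dotProduct_smul, star_trivial,
      smul_eq_mul]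
    linarith
  · have := frob_nonneg hX.1 h
    rw [frob_smul_one_sub hX.2] at this
    linarith

/-- Nash equilibria of a semidefinite game are exactly the solutions of the semidefinite
complementarity problem (inner-product form), and the multipliers are the payoffs. -/
theorem nash_iff_sdcp (m n : ℕ) (A B : Fin m → Fin m → Fin n → Fin n → ℝ)
    (hA : ∀ Y : Matrix (Fin n) (Fin n) ℝ, (PhiA A Y).IsSymm)
    (hB : ∀ X : Matrix (Fin m) (Fin m) ℝ, (PhiB B X).IsSymm)
    (X : Matrix (Fin m) (Fin m) ℝ) (Y : Matrix (Fin n) (Fin n) ℝ)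
    (hX : X ∈ Strat m) (hY : Y ∈ Strat n) :
    (((∀ X' ∈ Strat m, frob X' (PhiA A Y) ≤ frob X (PhiA A Y)) ∧
      (∀ Y' ∈ Strat n, frob (PhiB B X) Y' ≤ frob (PhiB B X) Y)) ↔
      (∃ w v : ℝ,
        (w • (1 : Matrix (Fin m) (Fin m) ℝ) - PhiA A Y).PosSemidef ∧
        (v • (1 : Matrix (Fin n) (Fin n) ℝ) - PhiB B X).PosSemidef ∧
        frob X (w • (1 : Matrix (Fin m) (Fin m) ℝ) - PhiA A Y) = 0 ∧
        frob Y (v • (1 : Matrix (Fin n) (Fin n) ℝ) - PhiB B X) = 0)) ∧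
    (∀ w v : ℝ,
        (w • (1 : Matrix (Fin m) (Fin m) ℝ) - PhiA A Y).PosSemidef →
        (v • (1 : Matrix (Fin n) (Fin n) ℝ) - PhiB B X).PosSemidef →
        frob X (w • (1 : Matrix (Fin m) (Fin m) ℝ) - PhiA A Y) = 0 →
        frob Y (v • (1 : Matrix (Fin n) (Fin n) ℝ) - PhiB B X) = 0 →
        w = frob X (PhiA A Y) ∧ v = frob (PhiB B X) Y) := by
  simp only [frob_comm (PhiB B X), frob_smul_one_sub hX.2, frob_smul_one_sub hY.2, sub_eq_zero]
  refine ⟨?_, fun w v _ _ hw hv => ⟨hw, hv⟩⟩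
  rw [forall_frob_le_iff_posSemidef (hA Y), forall_frob_le_iff_posSemidef (hB X)]
  constructor
  · rintro ⟨h₁, h₂⟩
    exact ⟨_, _, h₁, h₂, rfl, rfl⟩
  · rintro ⟨w, v, h₁, h₂, rfl, rfl⟩
    exact ⟨h₁, h₂⟩
end
end

section
/- Suppose the semidefinite game satisfies non-degeneracy condition (I): for every pair (X,Y) ∈ 𝒳 × 𝒴 one has rank V(X) ≥ n − rank X and rank W(Y) ≥ m − rank Y, where W(Y) = λ_max(Φ_A(Y))·I_m − Φ_A(Y) and V(X) = λ_max(Φ'_B(X))·I_n − Φ'_B(X). Then every Nash equilibrium (X,Y) of the game satisfies strict complementarity: rank X + rank W(Y) = m and rank Y + rank V(X) = n; in particular rank X = rank Y. -/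
open Matrix BigOperators

noncomputable section

/-- The largest eigenvalue of a (symmetric) real matrix. -/
def lamMax {p : ℕ} (M : Matrix (Fin p) (Fin p) ℝ) : ℝ :=
  sSup {c : ℝ | ∃ v : Fin p → ℝ, v ≠ 0 ∧ M.mulVec v = c • v}

lemma Matrix.IsSymm.isHermitian_of_real {p : ℕ} {P : Matrix (Fin p) (Fin p) ℝ} (h : P.IsSymm) :
    P.IsHermitian := by
  rwa [Matrix.IsHermitian, Matrix.conjTranspose_eq_transpose_of_trivial]

/-- Eigenvalue sets of real matrices are finite. -/
lemma finite_setOf_eigenvalue {p : ℕ} (P : Matrix (Fin p) (Fin p) ℝ) :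
    {c : ℝ | ∃ v : Fin p → ℝ, v ≠ 0 ∧ P.mulVec v = c • v}.Finite := by
  refine (Module.End.finite_hasEigenvalue (Matrix.toLin' P)).subset ?_
  rintro c ⟨v, hv, hPv⟩
  exact Module.End.hasEigenvalue_of_hasEigenvector (x := v)
    ⟨Module.End.mem_eigenspace_iff.2 (by simpa using hPv), hv⟩

lemma exists_mulVec_eq_lamMax_smul {p : ℕ} (hp : 0 < p) {P : Matrix (Fin p) (Fin p) ℝ}
    (hP : P.IsHermitian) : ∃ v : Fin p → ℝ, v ≠ 0 ∧ P.mulVec v = lamMax P • v := by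
  refine Set.Nonempty.csSup_mem ?_ (finite_setOf_eigenvalue P)
  refine ⟨hP.eigenvalues ⟨0, hp⟩, hP.eigenvectorBasis ⟨0, hp⟩, ?_,
    hP.mulVec_eigenvectorBasis _⟩
  intro h
  exact hP.eigenvectorBasis.toBasis.ne_zero ⟨0, hp⟩ (by ext i; simpa using congrFun h i)

lemma posSemidef_lamMax_smul_one_sub {p : ℕ} {P : Matrix (Fin p) (Fin p) ℝ}
    (hP : P.IsHermitian) :
    (lamMax P • (1 : Matrix (Fin p) (Fin p) ℝ) - P).PosSemidef := by
  have hW : (lamMax P • (1 : Matrix (Fin p) (Fin p) ℝ) - P).IsHermitian := by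
    refine Matrix.IsHermitian.sub ?_ hP
    simp [Matrix.IsHermitian]
  refine hW.posSemidef_iff_eigenvalues_nonneg.2 fun i => ?_
  have hle : lamMax P - hW.eigenvalues i ≤ lamMax P := by
    refine le_csSup (finite_setOf_eigenvalue P).bddAbove
      ⟨hW.eigenvectorBasis i, ?_, ?_⟩
    · intro h
      exact hW.eigenvectorBasis.toBasis.ne_zero i (by ext j; simpa using congrFun h j)
    · have h := hW.mulVec_eigenvectorBasis i
      rw [Matrix.sub_mulVec, Matrix.smul_mulVec, Matrix.one_mulVec] at h
      rw [sub_smul, ← h, sub_sub_cancel]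
  simpa using hle

lemma frob_eq_trace_mul {p : ℕ} {M N : Matrix (Fin p) (Fin p) ℝ} (hN : N.IsHermitian) :
    frob M N = (M * N).trace := by
  simp only [frob, Matrix.trace, Matrix.diag_apply, Matrix.mul_apply]
  refine Finset.sum_congr rfl fun i _ => Finset.sum_congr rfl fun j _ => ?_
  rw [← hN.apply i j]; simp

open scoped MatrixOrder Matrix.Norms.L2Operator in
/-- Positive semidefinite matrices whose product has nonpositive trace are orthogonal. -/
lemma Matrix.PosSemidef.mul_eq_zero_of_trace_mul_nonpos {p : ℕ}
    {X W : Matrix (Fin p) (Fin p) ℝ} (hX : X.PosSemidef) (hW : W.PosSemidef)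
    (h : (X * W).trace ≤ 0) : X * W = 0 := by
  obtain ⟨B, rfl⟩ := CStarAlgebra.nonneg_iff_eq_star_mul_self.1 hX.nonneg
  obtain ⟨C, rfl⟩ := CStarAlgebra.nonneg_iff_eq_star_mul_self.1 hW.nonneg
  simp only [Matrix.star_eq_conjTranspose] at h ⊢
  have htr : (Bᴴ * B * (Cᴴ * C)).trace = ((B * Cᴴ)ᴴ * (B * Cᴴ)).trace := by
    rw [← Matrix.mul_assoc, Matrix.trace_mul_comm, Matrix.conjTranspose_mul,
      Matrix.conjTranspose_conjTranspose]
    simp only [Matrix.mul_assoc]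
  have h0 : B * Cᴴ = 0 := Matrix.trace_conjTranspose_mul_self_eq_zero_iff.1
    (le_antisymm (htr ▸ h) (Matrix.posSemidef_conjTranspose_mul_self _).trace_nonneg)
  rw [Matrix.mul_assoc, ← Matrix.mul_assoc B, h0, Matrix.zero_mul, Matrix.mul_zero]

lemma frob_vecMulVec_self {p : ℕ} (v : Fin p → ℝ) (P : Matrix (Fin p) (Fin p) ℝ) :
    frob (Matrix.vecMulVec v v) P = v ⬝ᵥ P.mulVec v := by
  simp only [frob, Matrix.vecMulVec_apply, dotProduct, Matrix.mulVec, Finset.mul_sum]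
  exact Finset.sum_congr rfl fun i _ => Finset.sum_congr rfl fun j _ => by ring

lemma exists_strat_frob_eq_lamMax {p : ℕ} (hp : 0 < p) {P : Matrix (Fin p) (Fin p) ℝ}
    (hP : P.IsHermitian) : ∃ Z ∈ Strat p, frob Z P = lamMax P := by
  obtain ⟨v, hv, hPv⟩ := exists_mulVec_eq_lamMax_smul hp hP
  have hpos : 0 < v ⬝ᵥ v := by simpa using Matrix.dotProduct_star_self_pos_iff.2 hv
  refine ⟨(v ⬝ᵥ v)⁻¹ • Matrix.vecMulVec v v, ⟨?_, ?_⟩, ?_⟩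
  · exact (by simpa using Matrix.posSemidef_vecMulVec_self_star v :
      (Matrix.vecMulVec v v).PosSemidef).smul (inv_nonneg.2 hpos.le)
  · rw [Matrix.trace_smul, Matrix.trace_vecMulVec, smul_eq_mul, inv_mul_cancel₀ hpos.ne']
  · have hsmul : frob ((v ⬝ᵥ v)⁻¹ • Matrix.vecMulVec v v) P =
        (v ⬝ᵥ v)⁻¹ * frob (Matrix.vecMulVec v v) P := by
      simp only [frob, Matrix.smul_apply, smul_eq_mul, Finset.mul_sum, mul_assoc]
    rw [hsmul, frob_vecMulVec_self, hPv, dotProduct_smul, smul_eq_mul]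
    field_simp

/-- A best response to a payoff matrix is complementary to its slack matrix. -/
lemma rank_add_rank_slack_le {p : ℕ} {P X : Matrix (Fin p) (Fin p) ℝ} (hP : P.IsHermitian)
    (hX : X ∈ Strat p) (hmax : ∀ X' ∈ Strat p, frob X' P ≤ frob X P) :
    X.rank + (lamMax P • (1 : Matrix (Fin p) (Fin p) ℝ) - P).rank ≤ p := by
  have hp : 0 < p := by
    refine Nat.pos_of_ne_zero fun h => ?_
    subst h
    simpa using hX.2
  obtain ⟨Z, hZ, hZP⟩ := exists_strat_frob_eq_lamMax hp hP
  have hle := hmax Z hZ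
  rw [hZP, frob_eq_trace_mul hP] at hle
  have h0 : X * (lamMax P • (1 : Matrix (Fin p) (Fin p) ℝ) - P) = 0 := by
    refine hX.1.mul_eq_zero_of_trace_mul_nonpos (posSemidef_lamMax_smul_one_sub hP) ?_
    rw [Matrix.mul_sub, Matrix.trace_sub, Matrix.mul_smul, Matrix.mul_one, Matrix.trace_smul,
      hX.2, smul_eq_mul]
    linarith
  simpa using Matrix.rank_add_rank_le_card_of_mul_eq_zero h0

/-- Under non-degeneracy condition (I), every Nash equilibrium of a semidefinite game
satisfies strict complementarity; in particular, the ranks of the two strategies agree. -/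
theorem nondegenerate_implies_strict_complementarity (m n : ℕ)
    (A B : Fin m → Fin m → Fin n → Fin n → ℝ)
    (hA : ∀ Y : Matrix (Fin n) (Fin n) ℝ, (PhiA A Y).IsSymm)
    (hB : ∀ X : Matrix (Fin m) (Fin m) ℝ, (PhiB B X).IsSymm)
    (hI : ∀ X ∈ Strat m, ∀ Y ∈ Strat n,
      n - X.rank ≤ (lamMax (PhiB B X) • (1 : Matrix (Fin n) (Fin n) ℝ) - PhiB B X).rank ∧
      m - Y.rank ≤ (lamMax (PhiA A Y) • (1 : Matrix (Fin m) (Fin m) ℝ) - PhiA A Y).rank) :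
    ∀ X ∈ Strat m, ∀ Y ∈ Strat n,
      (∀ X' ∈ Strat m, frob X' (PhiA A Y) ≤ frob X (PhiA A Y)) →
      (∀ Y' ∈ Strat n, frob (PhiB B X) Y' ≤ frob (PhiB B X) Y) →
      X.rank + (lamMax (PhiA A Y) • (1 : Matrix (Fin m) (Fin m) ℝ) - PhiA A Y).rank = m ∧
      Y.rank + (lamMax (PhiB B X) • (1 : Matrix (Fin n) (Fin n) ℝ) - PhiB B X).rank = n ∧
      X.rank = Y.rank := by
 
  intro X hX Y hY hXmax hYmax
  have hW := rank_add_rank_slack_le (hA Y).isHermitian_of_real hX hXmax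
  have hV := rank_add_rank_slack_le (hB X).isHermitian_of_real hY fun Y' hY' => by
    simpa only [frob_comm (PhiB B X)] using hYmax Y' hY'
  obtain ⟨hI₁, hI₂⟩ := hI X hX Y hY
  omega
end
end

section
/- Let X ∈ Sym_m(ℝ) and Y ∈ Sym_n(ℝ) be positive semidefinite with trace one, and set W = I_m − Φ_A(Y) and V = I_n − Φ'_B(X). Assume X·W = 0, Y·V = 0, the column space of X equals the kernel of W, the kernel of X equals the column space of W, the column space of Y equals the kernel of V, and the kernel of Y equals the column space of V. Assume further that the set {(X',Y') ∈ Sym_m(ℝ) × Sym_n(ℝ) : X'·(I_m − Φ_A(Y')) = 0 and Y'·(I_n − Φ'_B(X')) = 0} is finite. Then for all symmetric matrices H ∈ Sym_m(ℝ) and K ∈ Sym_n(ℝ) satisfying W·H − X·Φ_A(K) = 0 and −Y·Φ'_B(H) + V·K = 0, one has H = 0 and K = 0. -/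
open Matrix BigOperators

noncomputable section

theorem PhiA_add_smul {m n : ℕ} (A : Fin m → Fin m → Fin n → Fin n → ℝ)
    (Y K : Matrix (Fin n) (Fin n) ℝ) (t : ℝ) :
    PhiA A (Y + t • K) = PhiA A Y + t • PhiA A K := by
  ext i j
  simp [PhiA, mul_add, Finset.sum_add_distrib, Finset.mul_sum, mul_left_comm]

theorem PhiB_add_smul {m n : ℕ} (B : Fin m → Fin m → Fin n → Fin n → ℝ)
    (X H : Matrix (Fin m) (Fin m) ℝ) (t : ℝ) :
    PhiB B (X + t • H) = PhiB B X + t • PhiB B H := by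
  ext k l
  simp [PhiB, add_mul, Finset.sum_add_distrib, Finset.mul_sum, mul_assoc]

theorem exists_eq_mul_of_ker_le_range {ι : Type*} [Fintype ι] {X W H : Matrix ι ι ℝ}
    (hker : LinearMap.ker W.mulVecLin ≤ LinearMap.range X.mulVecLin) (hWH : W * H = 0) :
    ∃ M : Matrix ι ι ℝ, H = X * M := by
  have hcol (j : ι) : ∃ v : ι → ℝ, X *ᵥ v = fun i => H i j := by
    apply hker
    ext i
    exact congrFun (congrFun hWH i) j
  choose v hv using hcol
  refine ⟨Matrix.of fun i j => v j i, ?_⟩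
  ext i j
  exact (congrFun (hv j) i).symm

/-- A solution `H`, `P` of the linearization of `X * W = 0` is an exact solution along the whole
line through `(X, W)` when the kernel of `W` is contained in the range of `X`. -/
theorem add_smul_mul_sub_smul_eq_zero {ι : Type*} [Fintype ι] {X W H P : Matrix ι ι ℝ}
    (hX : X.IsSymm) (hW : W.IsSymm) (hH : H.IsSymm) (hXW : X * W = 0)
    (hker : LinearMap.ker W.mulVecLin ≤ LinearMap.range X.mulVecLin)
    (hlin : W * H - X * P = 0) (t : ℝ) :
    (X + t • H) * (W - t • P) = 0 := by
  have hWH : W * H = X * P := sub_eq_zero.mp hlin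
  have hXP : X * P = 0 := by
    refine (Matrix.conjTranspose_mul_self_mul_eq_zero X P).mp ?_
    rw [Matrix.conjTranspose_eq_transpose_of_trivial, hX.eq, Matrix.mul_assoc, ← hWH,
      ← Matrix.mul_assoc, hXW, Matrix.zero_mul]
  rw [hXP] at hWH
  have hHW : H * W = 0 := by
    simpa [Matrix.transpose_mul, hH.eq, hW.eq] using congrArg Matrix.transpose hWH
  obtain ⟨M, hM⟩ := exists_eq_mul_of_ker_le_range hker hWH
  have hHP : H * P = 0 := by
    rw [← hH.eq, hM, Matrix.transpose_mul, hX.eq, Matrix.mul_assoc, hXP, Matrix.mul_zero]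
  simp [Matrix.add_mul, Matrix.mul_sub, hXW, hXP, hHW, hHP]

theorem eq_zero_of_finite_of_forall_add_smul_mem {E : Type*} [AddCommGroup E] [Module ℝ E]
    {S : Set E} (hS : S.Finite) {p v : E} (h : ∀ t : ℝ, p + t • v ∈ S) : v = 0 := by
  by_contra hv
  exact Set.infinite_of_injective_forall_mem
    (fun s t hst => smul_left_injective ℝ hv (add_left_cancel hst)) h hS

/-- Injectivity of the differential of
`(X,Y) ↦ (X·(I − Φ_A(Y)), Y·(I − Φ'_B(X)))` at a non-degenerate point of the
Lemke–Howson path: smoothness of the path. -/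
theorem differential_injective_on_path (m n : ℕ)
    (A B : Fin m → Fin m → Fin n → Fin n → ℝ)
    (hA : ∀ Y : Matrix (Fin n) (Fin n) ℝ, (PhiA A Y).IsSymm)
    (hB : ∀ X : Matrix (Fin m) (Fin m) ℝ, (PhiB B X).IsSymm)
    (X : Matrix (Fin m) (Fin m) ℝ) (Y : Matrix (Fin n) (Fin n) ℝ)
    (hX : X.PosSemidef) (hXtr : X.trace = 1)
    (hY : Y.PosSemidef) (hYtr : Y.trace = 1)
    (hXW : X * ((1 : Matrix (Fin m) (Fin m) ℝ) - PhiA A Y) = 0)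
    (hYV : Y * ((1 : Matrix (Fin n) (Fin n) ℝ) - PhiB B X) = 0)
    (h1 : LinearMap.range X.mulVecLin =
      LinearMap.ker ((1 : Matrix (Fin m) (Fin m) ℝ) - PhiA A Y).mulVecLin)
    (h2 : LinearMap.ker X.mulVecLin =
      LinearMap.range ((1 : Matrix (Fin m) (Fin m) ℝ) - PhiA A Y).mulVecLin)
    (h3 : LinearMap.range Y.mulVecLin =
      LinearMap.ker ((1 : Matrix (Fin n) (Fin n) ℝ) - PhiB B X).mulVecLin)
    (h4 : LinearMap.ker Y.mulVecLin =
      LinearMap.range ((1 : Matrix (Fin n) (Fin n) ℝ) - PhiB B X).mulVecLin)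
    (hfin : {p : Matrix (Fin m) (Fin m) ℝ × Matrix (Fin n) (Fin n) ℝ |
        p.1.IsSymm ∧ p.2.IsSymm ∧
        p.1 * ((1 : Matrix (Fin m) (Fin m) ℝ) - PhiA A p.2) = 0 ∧
        p.2 * ((1 : Matrix (Fin n) (Fin n) ℝ) - PhiB B p.1) = 0}.Finite) :
    ∀ (H : Matrix (Fin m) (Fin m) ℝ) (K : Matrix (Fin n) (Fin n) ℝ),
      H.IsSymm → K.IsSymm →
      ((1 : Matrix (Fin m) (Fin m) ℝ) - PhiA A Y) * H - X * PhiA A K = 0 →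
      -(Y * PhiB B H) + ((1 : Matrix (Fin n) (Fin n) ℝ) - PhiB B X) * K = 0 →
      H = 0 ∧ K = 0 := by
  intro H K hH hK hHlin hKlin
  have hXs : X.IsSymm := by simpa [Matrix.IsSymm] using hX.isHermitian.eq
  have hYs : Y.IsSymm := by simpa [Matrix.IsSymm] using hY.isHermitian.eq
  have hVlin : (1 - PhiB B X) * K - Y * PhiB B H = 0 := by
    rw [← hKlin]; abel
  refine Prod.mk_eq_zero.mp
    (eq_zero_of_finite_of_forall_add_smul_mem (p := (X, Y)) (v := (H, K)) hfin fun t => ?_)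
  refine ⟨hXs.add (hH.smul t), hYs.add (hK.smul t), ?_, ?_⟩
  · simpa [PhiA_add_smul, sub_sub] using
      add_smul_mul_sub_smul_eq_zero hXs (Matrix.isSymm_one.sub (hA Y)) hH hXW h1.ge hHlin t
  · simpa [PhiB_add_smul, sub_sub] using
      add_smul_mul_sub_smul_eq_zero hYs (Matrix.isSymm_one.sub (hB X)) hK hYV h3.ge hVlin t
end
end

section
/- Let A, B ∈ ℝ^{m×n}, and let x ∈ ℝ^m_{≥0}, y ∈ ℝ^n_{≥0} satisfy x ⊙ (1_m − Ay) = 0 and (1_n − Bᵀx) ⊙ y = 0, with strict complementarity: for every i exactly one of x_i = 0 and (1_m − Ay)_i = 0 holds, and for every j exactly one of y_j = 0 and (1_n − Bᵀx)_j = 0 holds. Let K = supp(x) and L = supp(y). Assume the submatrix of A with rows indexed by K and columns indexed by L defines an injective linear map ℝ^L → ℝ^K, and the submatrix of Bᵀ with rows indexed by L and columns indexed by K defines an injective linear map ℝ^K → ℝ^L. Then the only pair (dx, dy) ∈ ℝ^m × ℝ^n satisfying dx ⊙ (1_m − Ay) − x ⊙ (A·dy) = 0 and −(Bᵀ·dx)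 ⊙ y + (1_n − Bᵀx) ⊙ dy = 0 is dx = 0, dy = 0. -/
open Matrix BigOperators
open scoped Classical

/-- A vector supported on `q` is zero if its image under `M` vanishes on `p` and the submatrix of
`M` with rows in `p` and columns in `q` is injective. -/
theorem Matrix.eq_zero_of_submatrix_mulVecLin_injective {α β R : Type*} [Fintype β]
    [CommSemiring R] {p : α → Prop} {q : β → Prop} [Fintype {j // q j}] {M : Matrix α β R}
    (hM : Function.Injective (M.submatrix (fun i : {i // p i} => i.1)
      (fun j : {j // q j} => j.1)).mulVecLin)
    {v : β → R} (hv : ∀ j, ¬ q j → v j = 0) (hMv : ∀ i, p i → M.mulVec v i = 0) : v = 0 := by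
  have hzero : (fun j : {j // q j} => v j.1) = 0 := by
    apply hM
    rw [map_zero]
    ext i
    rw [Pi.zero_apply, ← hMv i.1 i.2]
    simp only [Matrix.mulVecLin_apply, Matrix.mulVec, dotProduct, Matrix.submatrix_apply]
    rw [← Finset.sum_subtype (Finset.univ.filter q) (by simp) (fun j => M i.1 j * v j)]
    exact Finset.sum_filter_of_ne fun j _ hj => by_contra fun hq => hj (by rw [hv j hq, mul_zero])
  ext j
  by_cases hj : q j
  · exact congrFun hzero ⟨j, hj⟩
  · exact hv j hj

/-- Smoothness of the Lemke–Howson path of a non-degenerate bimatrix game at a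
non-event point: the differential of the complementarity map is injective. -/
theorem bimatrix_differential_injective (m n : ℕ) (A B : Matrix (Fin m) (Fin n) ℝ)
    (x : Fin m → ℝ) (y : Fin n → ℝ)
    (hx : ∀ i, 0 ≤ x i) (hy : ∀ j, 0 ≤ y j)
    (hcx : ∀ i, x i * ((1 : Fin m → ℝ) - A.mulVec y) i = 0)
    (hcy : ∀ j, ((1 : Fin n → ℝ) - Bᵀ.mulVec x) j * y j = 0)
    (hscx : ∀ i, Xor' (x i = 0) (((1 : Fin m → ℝ) - A.mulVec y) i = 0))
    (hscy : ∀ j, Xor' (y j = 0) (((1 : Fin n → ℝ) - Bᵀ.mulVec x) j = 0))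
    (hKL : Function.Injective
      (A.submatrix (fun i : {i : Fin m // x i ≠ 0} => i.1)
        (fun j : {j : Fin n // y j ≠ 0} => j.1)).mulVecLin)
    (hLK : Function.Injective
      ((Bᵀ).submatrix (fun j : {j : Fin n // y j ≠ 0} => j.1)
        (fun i : {i : Fin m // x i ≠ 0} => i.1)).mulVecLin) :
    ∀ (dx : Fin m → ℝ) (dy : Fin n → ℝ),
      (∀ i, dx i * ((1 : Fin m → ℝ) - A.mulVec y) i - x i * A.mulVec dy i = 0) →
      (∀ j, -(Bᵀ.mulVec dx j * y j) + ((1 : Fin n → ℝ) - Bᵀ.mulVec x) j * dy j = 0) →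
      dx = 0 ∧ dy = 0 := by
  intro dx dy h₁ h₂
  constructor
  · refine Matrix.eq_zero_of_submatrix_mulVecLin_injective hLK (fun i hi => ?_) (fun j hj => ?_)
    · have hxi : x i = 0 := not_not.mp hi
      have hs : ((1 : Fin m → ℝ) - A.mulVec y) i ≠ 0 := (xor_iff_iff_not.mp (hscx i)).mp hxi
      simpa [hxi, -Pi.sub_apply, hs] using h₁ i
    · have hs := (mul_eq_zero.mp (hcy j)).resolve_right hj
      simpa [hs, -Pi.sub_apply, hj] using h₂ j
  · refine Matrix.eq_zero_of_submatrix_mulVecLin_injective hKL (fun j hj => ?_) (fun i hi => ?_)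
    · have hyj : y j = 0 := not_not.mp hj
      have hs : ((1 : Fin n → ℝ) - Bᵀ.mulVec x) j ≠ 0 := (xor_iff_iff_not.mp (hscy j)).mp hyj
      simpa [hyj, -Pi.sub_apply, hs] using h₂ j
    · have hs := (mul_eq_zero.mp (hcx i)).resolve_left hi
      simpa [hs, -Pi.sub_apply, hi] using h₁ i
end

section
/- Consider the semidefinite game with m = n = 2 in which both players' payoff is p(X,Y) = X_{11}Y_{11} + 4c·X_{12}Y_{12}, i.e., Φ_A(Y) = Φ'_B(Y) = [[Y_{11}, 2cY_{12}],[2cY_{12}, 0]], with a constant c > 1/2. Then X = Y = [[1,0],[0,0]] and X = Y = [[0,0],[0,1]] are Nash equilibria, and the equilibrium X = Y = [[0,0],[0,1]] does not satisfy strict complementarity: with w = v = 0 being the equilibrium payoffs, W = w·I_2 − Φ_A(Y) and V = v·I_2 − Φ'_B(X) are the zero matrix, so rank X + rank W = 1 < 2. -/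
open Matrix BigOperators

noncomputable section

/-- The payoff matrix `Φ_A(Y) = Φ'_B(Y) = [[Y₁₁, 2cY₁₂],[2cY₁₂, 0]]` of the game with
payoff `p(X,Y) = X₁₁Y₁₁ + 4c·X₁₂Y₁₂`. -/
def Phi (c : ℝ) (Y : Matrix (Fin 2) (Fin 2) ℝ) : Matrix (Fin 2) (Fin 2) ℝ :=
  !![Y 0 0, 2 * c * Y 0 1; 2 * c * Y 0 1, 0]

/-- `(M, M)` is a Nash equilibrium of the symmetric semidefinite game with payoff
operator `Φ c`. -/
def IsNE (c : ℝ) (M : Matrix (Fin 2) (Fin 2) ℝ) : Prop :=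
  M ∈ Strat 2 ∧
  (∀ X' ∈ Strat 2, frob X' (Phi c M) ≤ frob M (Phi c M)) ∧
  (∀ Y' ∈ Strat 2, frob (Phi c M) Y' ≤ frob (Phi c M) M)

theorem posSemidef_diagonal_pair {a b : ℝ} (ha : 0 ≤ a) (hb : 0 ≤ b) :
    (!![a, 0; 0, b] : Matrix (Fin 2) (Fin 2) ℝ).PosSemidef := by
  have h : (!![a, 0; 0, b] : Matrix (Fin 2) (Fin 2) ℝ) = Matrix.diagonal ![a, b] := by
    ext i j
    fin_cases i <;> fin_cases j <;> simp
  rw [h]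
  refine Matrix.PosSemidef.diagonal fun i => ?_
  fin_cases i <;> simpa

theorem apply_zero_zero_le_one_of_mem_strat {X : Matrix (Fin 2) (Fin 2) ℝ}
    (hX : X ∈ Strat 2) : X 0 0 ≤ 1 := by
  have h1 : 0 ≤ X 1 1 := hX.1.diag_nonneg
  have h2 := hX.2
  rw [Matrix.trace_fin_two] at h2
  linarith

theorem rank_diagonal_zero_one :
    (!![0, 0; 0, 1] : Matrix (Fin 2) (Fin 2) ℝ).rank = 1 := by
  have h : (!![0, 0; 0, 1] : Matrix (Fin 2) (Fin 2) ℝ) = Matrix.diagonal ![0, 1] := by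
    ext i j
    fin_cases i <;> fin_cases j <;> simp
  rw [h, Matrix.rank_diagonal, Fintype.card_eq_one_iff]
  refine ⟨⟨1, by simp⟩, fun ⟨i, hi⟩ => ?_⟩
  fin_cases i
  · simp at hi
  · rfl

theorem phi_diagonal (c a b : ℝ) : Phi c !![a, 0; 0, b] = !![a, 0; 0, 0] := by
  simp [Phi]

/-- In the game with payoff `p(X,Y) = X₁₁Y₁₁ + 4c·X₁₂Y₁₂`, `c > 1/2`, the diagonal pure
strategies give Nash equilibria, and the equilibrium `X = Y = [[0,0],[0,1]]` (with
equilibrium payoffs `w = v = 0`) fails strict complementarity: its slack matrices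
vanish, so `rank X + rank W = 1 < 2`. -/
theorem degenerate_equilibrium_fails_strict_complementarity (c : ℝ) (hc : 1 / 2 < c) :
    IsNE c !![1, 0; 0, 0] ∧
    IsNE c !![0, 0; 0, 1] ∧
    frob !![0, 0; 0, 1] (Phi c !![0, 0; 0, 1]) = 0 ∧
    frob (Phi c !![0, 0; 0, 1]) !![0, 0; 0, 1] = 0 ∧
    (0 : ℝ) • (1 : Matrix (Fin 2) (Fin 2) ℝ) - Phi c !![0, 0; 0, 1] = 0 ∧
    (!![0, 0; 0, 1] : Matrix (Fin 2) (Fin 2) ℝ).rank +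
      ((0 : ℝ) • (1 : Matrix (Fin 2) (Fin 2) ℝ) - Phi c !![0, 0; 0, 1]).rank = 1 ∧
    (1 : ℕ) < 2 := by
  have hz : (!![0, 0; 0, 0] : Matrix (Fin 2) (Fin 2) ℝ) = 0 := by
    ext i j
    fin_cases i <;> fin_cases j <;> rfl
  simp only [IsNE, phi_diagonal]
  refine ⟨⟨⟨posSemidef_diagonal_pair zero_le_one le_rfl, ?_⟩, fun X hX => ?_, fun X hX => ?_⟩,
    ⟨⟨posSemidef_diagonal_pair le_rfl zero_le_one, ?_⟩, fun X _ => ?_, fun X _ => ?_⟩,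
    ?_, ?_, ?_, ?_, one_lt_two⟩
  · simp [Matrix.trace_fin_two]
  · simpa [frob, Fin.sum_univ_two] using apply_zero_zero_le_one_of_mem_strat hX
  · simpa [frob, Fin.sum_univ_two] using apply_zero_zero_le_one_of_mem_strat hX
  · simp [Matrix.trace_fin_two]
  · simp [frob, Fin.sum_univ_two]
  · simp [frob, Fin.sum_univ_two]
  · simp [frob, Fin.sum_univ_two]
  · simp [frob, Fin.sum_univ_two]
  · rw [hz, zero_smul, sub_zero]
  · rw [hz, zero_smul, sub_zero, Matrix.rank_zero, rank_diagonal_zero_one]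
end
end

section
/- Consider the semidefinite game with m = n = 2 in which both players' payoff is p(X,Y) = X_{11}Y_{11} + 4c·X_{12}Y_{12}, with a constant c > 1/2. Then for each choice of sign ε ∈ {+1, −1}, the pair X = Y = [[2c/(4c−1), ε·√(2c(2c−1))/(4c−1)],[ε·√(2c(2c−1))/(4c−1), (2c−1)/(4c−1)]] is a Nash equilibrium, and its equilibrium payoff to each player is 4c²/(4c−1). -/
open Matrix BigOperators

noncomputable section

/-- The candidate interior equilibrium strategy with sign `ε`. -/
def Meq (c ε : ℝ) : Matrix (Fin 2) (Fin 2) ℝ :=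
  !![2 * c / (4 * c - 1), ε * Real.sqrt (2 * c * (2 * c - 1)) / (4 * c - 1);
     ε * Real.sqrt (2 * c * (2 * c - 1)) / (4 * c - 1), (2 * c - 1) / (4 * c - 1)]

/-- The scalar `ε √(2c(2c-1))` squares to `2c(2c-1)`. -/
lemma sign_mul_sqrt_sq {c ε : ℝ} (hc : 1 / 2 < c) (hε : ε = 1 ∨ ε = -1) :
    (ε * Real.sqrt (2 * c * (2 * c - 1))) ^ 2 = 2 * c * (2 * c - 1) := by
  have hsq : ε ^ 2 = 1 := by rcases hε with rfl | rfl <;> norm_num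
  rw [mul_pow, hsq, one_mul, Real.sq_sqrt (by nlinarith)]

lemma posSemidef_fin_two_quadratic_nonneg {X : Matrix (Fin 2) (Fin 2) ℝ} (hX : X.PosSemidef)
    (u v : ℝ) : 0 ≤ X 0 0 * u ^ 2 + 2 * X 0 1 * u * v + X 1 1 * v ^ 2 := by
  have h := hX.dotProduct_mulVec_nonneg ![u, v]
  have hsymm : X 1 0 = X 0 1 := by simpa using hX.isHermitian.apply 0 1
  simp only [dotProduct, mulVec, Fin.sum_univ_two, star_trivial, cons_val_zero, cons_val_one,
    hsymm] at h
  linarith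

lemma Meq_mem_Strat {c ε : ℝ} (hc : 1 / 2 < c) (hε : ε = 1 ∨ ε = -1) : Meq c ε ∈ Strat 2 := by
  have hc0 : 0 < c := by linarith
  have hd : 0 < 4 * c - 1 := by linarith
  have hne := hd.ne'
  have hs := sign_mul_sqrt_sq hc hε
  refine ⟨.of_dotProduct_mulVec_nonneg ?_ fun x => ?_, ?_⟩
  · ext i j
    fin_cases i <;> fin_cases j <;> simp [Meq]
  · simp only [Meq, dotProduct, mulVec, Fin.sum_univ_two, star_trivial, of_apply, cons_val_zero,
      cons_val_one, cons_val']
    generalize ε * Real.sqrt (2 * c * (2 * c - 1)) = s at *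
    have key : 0 ≤ (2 * c * x 0 + s * x 1) ^ 2 / (2 * c * (4 * c - 1)) := by positivity
    refine key.trans_eq ?_
    generalize hdc : 4 * c - 1 = d at *
    field_simp
    linear_combination x 1 ^ 2 * hs
  · simp only [Meq, trace_fin_two, of_apply, cons_val_zero, cons_val_one, cons_val']
    rw [← add_div, div_eq_one_iff_eq hne]
    ring

lemma frob_Meq_Phi_Meq {c ε : ℝ} (hc : 1 / 2 < c) (hε : ε = 1 ∨ ε = -1) :
    frob (Meq c ε) (Phi c (Meq c ε)) = 4 * c ^ 2 / (4 * c - 1) := by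
  have hd : 0 < 4 * c - 1 := by linarith
  have hne := hd.ne'
  have hs := sign_mul_sqrt_sq hc hε
  simp only [frob, Phi, Meq, Fin.sum_univ_two, of_apply, cons_val_zero, cons_val_one, cons_val']
  generalize ε * Real.sqrt (2 * c * (2 * c - 1)) = s at *
  generalize hdc : 4 * c - 1 = d at *
  field_simp
  linear_combination 4 * c * hs + 4 * c ^ 2 * hdc

/-- The largest eigenvalue of `Phi c (Meq c ε)` bounds the payoff of every strategy. -/
lemma frob_Phi_Meq_le {c ε : ℝ} (hc : 1 / 2 < c) (hε : ε = 1 ∨ ε = -1)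
    {X : Matrix (Fin 2) (Fin 2) ℝ} (hX : X ∈ Strat 2) :
    frob X (Phi c (Meq c ε)) ≤ 4 * c ^ 2 / (4 * c - 1) := by
  obtain ⟨hpos, htr⟩ := hX
  have hd : 0 < 4 * c - 1 := by linarith
  have hne := hd.ne'
  have hs := sign_mul_sqrt_sq hc hε
  have hsymm : X 1 0 = X 0 1 := by simpa using hpos.isHermitian.apply 0 1
  have hq := posSemidef_fin_two_quadratic_nonneg hpos
    (ε * Real.sqrt (2 * c * (2 * c - 1))) (-(2 * c))
  rw [trace_fin_two] at htr
  simp only [frob, Phi, Meq, Fin.sum_univ_two, of_apply, cons_val_zero, cons_val_one, cons_val',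
    hsymm]
  generalize ε * Real.sqrt (2 * c * (2 * c - 1)) = s at *
  rw [← sub_nonneg]
  refine (div_nonneg hq hd.le).trans_eq ?_
  generalize hdc : 4 * c - 1 = d at *
  field_simp
  linear_combination X 0 0 * hs + 4 * c ^ 2 * htr

/-- For each sign `ε = ±1`, the pair `X = Y = Meq c ε` is a Nash equilibrium of the game
with payoff `p(X,Y) = X₁₁Y₁₁ + 4c·X₁₂Y₁₂`, `c > 1/2`, with equilibrium payoff
`4c²/(4c−1)` to each player. -/
theorem interior_nash_equilibria (c : ℝ) (hc : 1 / 2 < c) (ε : ℝ) (hε : ε = 1 ∨ ε = -1) :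
    Meq c ε ∈ Strat 2 ∧
    (∀ X' ∈ Strat 2, frob X' (Phi c (Meq c ε)) ≤ frob (Meq c ε) (Phi c (Meq c ε))) ∧
    (∀ Y' ∈ Strat 2, frob (Phi c (Meq c ε)) Y' ≤ frob (Phi c (Meq c ε)) (Meq c ε)) ∧
    frob (Meq c ε) (Phi c (Meq c ε)) = 4 * c ^ 2 / (4 * c - 1) ∧
    frob (Phi c (Meq c ε)) (Meq c ε) = 4 * c ^ 2 / (4 * c - 1) := by
  have hval := frob_Meq_Phi_Meq hc hε
  refine ⟨Meq_mem_Strat hc hε, fun X hX => ?_, fun Y hY => ?_, hval, ?_⟩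
  · exact (frob_Phi_Meq_le hc hε hX).trans_eq hval.symm
  · rw [frob_comm _ Y, frob_comm _ (Meq c ε), hval]
    exact frob_Phi_Meq_le hc hε hY
  · rw [frob_comm, hval]
end
end

section
/- Consider the hybrid game in which player 1's strategy space is the simplex Δ_2 = {x ∈ ℝ²_{≥0} : x₁ + x₂ = 1}, player 2's strategy space is 𝒴 = {Y ∈ Sym_2(ℝ) : Y positive semidefinite, tr Y = 1}, and the payoffs are p_A(x,Y) = x₁·⟨A₁,Y⟩ + x₂·⟨A₂,Y⟩ and p_B(x,Y) = x₁·⟨B₁,Y⟩ + x₂·⟨B₂,Y⟩ with A₁ = [[1,0],[0,1]], A₂ = [[2, 1/5],[1/5, 2]], B₁ = [[2,0],[0,1]], B₂ = [[2, 1/10],[1/10, 1]]. Then the pair x = (0,1), Y = [[1/2 + 5√26/52, √26/52],[√26/52, 1/2 − 5√26/52]] is a Nash equilibrium: x maximizes p_A(·,Y) over Δ_2 and Y maximizes p_B(x,·) over 𝒴. -/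
open Matrix BigOperators

noncomputable section

def A1 : Matrix (Fin 2) (Fin 2) ℝ := !![1, 0; 0, 1]
def A2 : Matrix (Fin 2) (Fin 2) ℝ := !![2, 1/5; 1/5, 2]
def B1 : Matrix (Fin 2) (Fin 2) ℝ := !![2, 0; 0, 1]
def B2 : Matrix (Fin 2) (Fin 2) ℝ := !![2, 1/10; 1/10, 1]

/-- Payoff of player 1 in the hybrid game. -/
def pA (x : Fin 2 → ℝ) (Y : Matrix (Fin 2) (Fin 2) ℝ) : ℝ :=
  x 0 * frob A1 Y + x 1 * frob A2 Y

/-- Payoff of player 2 in the hybrid game. -/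
def pB (x : Fin 2 → ℝ) (Y : Matrix (Fin 2) (Fin 2) ℝ) : ℝ :=
  x 0 * frob B1 Y + x 1 * frob B2 Y

/-- The equilibrium strategy of player 2. -/
def Ystar : Matrix (Fin 2) (Fin 2) ℝ :=
  !![1/2 + 5 * Real.sqrt 26 / 52, Real.sqrt 26 / 52;
     Real.sqrt 26 / 52, 1/2 - 5 * Real.sqrt 26 / 52]

lemma Ystar_posSemidef : Ystar.PosSemidef := by
  have hs : Real.sqrt 26 * Real.sqrt 26 = 26 := Real.mul_self_sqrt (by norm_num)
  have hs0 : 0 ≤ Real.sqrt 26 := Real.sqrt_nonneg _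
  refine .of_dotProduct_mulVec_nonneg ?_ fun v => ?_
  · ext i j
    fin_cases i <;> fin_cases j <;> simp [Ystar]
  · simp only [Ystar, dotProduct, mulVec, Fin.sum_univ_two, Pi.star_apply, star_trivial,
      of_apply, cons_val_zero, cons_val_one]
    generalize Real.sqrt 26 = s at hs hs0 ⊢
    generalize v 0 = x
    generalize v 1 = y
    have ha : 0 < 1 / 2 + 5 * s / 52 := by positivity
    refine nonneg_of_mul_nonneg_right (a := 1 / 2 + 5 * s / 52) ?_ ha
    have key := sq_nonneg ((1 / 2 + 5 * s / 52) * x + s / 52 * y)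
    linear_combination key + (y ^ 2 / 104) * hs

lemma frob_fin_two (M N : Matrix (Fin 2) (Fin 2) ℝ) :
    frob M N = M 0 0 * N 0 0 + M 0 1 * N 0 1 + (M 1 0 * N 1 0 + M 1 1 * N 1 1) := by
  simp [frob, Fin.sum_univ_two]

lemma frob_B2_le {Y : Matrix (Fin 2) (Fin 2) ℝ} (hY : Y ∈ Strat 2) :
    frob B2 Y ≤ 3 / 2 + Real.sqrt 26 / 10 := by
  obtain ⟨hpos, htr⟩ := hY
  have hdet := hpos.det_nonneg
  have hsymm : Y 1 0 = Y 0 1 := by simpa using hpos.1.apply 0 1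
  rw [trace_fin_two] at htr
  rw [det_fin_two, hsymm] at hdet
  have hc : Y 1 1 = 1 - Y 0 0 := by linarith
  have hle : 5 * (2 * Y 0 0 - 1) + 2 * Y 0 1 ≤ Real.sqrt 26 := by
    apply Real.le_sqrt_of_sq_le
    rw [hc] at hdet
    nlinarith [sq_nonneg (10 * Y 0 1 - (2 * Y 0 0 - 1))]
  simp only [frob_fin_two, B2, of_apply, cons_val', cons_val_zero, cons_val_one, hsymm, hc]
  linarith

lemma frob_B2_Ystar : frob B2 Ystar = 3 / 2 + Real.sqrt 26 / 10 := by
  simp only [frob_fin_two, B2, Ystar, of_apply, cons_val', cons_val_zero, cons_val_one]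
  ring

/-- The pair `x = (0,1)`, `Y = Ystar` is a Nash equilibrium of the hybrid game. -/
theorem hybrid_game_nash_equilibrium :
    (![0, 1] : Fin 2 → ℝ) ∈ stdSimplex ℝ (Fin 2) ∧
    Ystar ∈ Strat 2 ∧
    (∀ x' ∈ stdSimplex ℝ (Fin 2), pA x' Ystar ≤ pA ![0, 1] Ystar) ∧
    (∀ Y' ∈ Strat 2, pB ![0, 1] Y' ≤ pB ![0, 1] Ystar) := by
  refine ⟨⟨fun i => ?_, by simp⟩, ⟨Ystar_posSemidef, ?_⟩, fun x hx => ?_, fun Y hY => ?_⟩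
  · fin_cases i <;> simp
  · simp only [trace_fin_two, Ystar, of_apply, cons_val', cons_val_zero, cons_val_one]
    ring
  · have h0 := hx.1 0
    have h1 : x 1 = 1 - x 0 := by
      have := hx.2
      rw [Fin.sum_univ_two] at this
      linarith
    simp only [pA, frob_fin_two, A1, A2, Ystar, of_apply, cons_val', cons_val_zero,
      cons_val_one, h1]
    nlinarith [mul_nonneg h0 (Real.sqrt_nonneg 26)]
  · simpa [pB, frob_B2_Ystar] using frob_B2_le hY
end
end
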